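/- arXiv:2604.26723 — 15 statements merged into one kernel-verified Lean document; each statement's English description precedes it below -/
import Mathlib

section
/- Let k be a field, V a k-vector space, φ ∈ End(V), m a positive integer, h a {1}-inverse of φ, and g ∈ End(V) an endomorphism satisfying φ∘g∘φ = φ and g∘φ^m = φ^m∘g. Then ψ = g∘φ∘h satisfies the system ψ∘φ∘ψ = ψ, ψ∘φ = g∘φ, φ∘ψ = φ∘h; moreover, ψ = g∘φ∘h is the unique endomorphism of V satisfying these three equations. -/
/-- `h` is a `{1}`-inverse of `φ`: `φ∘h∘φ = φ`. -/
def IsOneInv {k V : Type*} [Field k] [AddCommGroup V] [Module k V]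
    (φ h : Module.End k V) : Prop := φ * h * φ = φ

/-- `g` is a G-Drazin inverse of `φ` (of index `m`): `φ∘g∘φ = φ` and `g∘φ^m = φ^m∘g`. -/
def IsGDrazin {k V : Type*} [Field k] [AddCommGroup V] [Module k V]
    (φ : Module.End k V) (m : ℕ) (g : Module.End k V) : Prop :=
  φ * g * φ = φ ∧ g * φ ^ m = φ ^ m * g

/-- `ψ` is a GD1 inverse of `φ` (of index `m`). -/
def IsGD1 {k V : Type*} [Field k] [AddCommGroup V] [Module k V]
    (φ : Module.End k V) (m : ℕ) (ψ : Module.End k V) : Prop :=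
  ψ * φ * ψ = ψ ∧ ∃ g h : Module.End k V,
    IsGDrazin φ m g ∧ IsOneInv φ h ∧ ψ * φ = g * φ ∧ φ * ψ = φ * h

/-- `ψ` is a 1GD inverse of `φ` (of index `m`). -/
def Is1GD {k V : Type*} [Field k] [AddCommGroup V] [Module k V]
    (φ : Module.End k V) (m : ℕ) (ψ : Module.End k V) : Prop :=
  ψ * φ * ψ = ψ ∧ ∃ h g : Module.End k V,
    IsOneInv φ h ∧ IsGDrazin φ m g ∧ ψ * φ = h * φ ∧ φ * ψ = φ * g

/-- `φ` admits an AST decomposition with subspaces `W`, `U` and index `m`. -/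
def IsAST {k V : Type*} [Field k] [AddCommGroup V] [Module k V]
    (φ : Module.End k V) (W U : Submodule k V) (m : ℕ) : Prop :=
  IsCompl W U ∧ (∀ w ∈ W, φ w ∈ W) ∧ (∀ u ∈ U, φ u ∈ U) ∧
  FiniteDimensional k W ∧ Set.BijOn (⇑φ) (W : Set V) (W : Set V) ∧
  IsLeast {n : ℕ | ∀ u ∈ U, (φ ^ n) u = 0} m

/-- `φ` is finite potent: `φ^n(V)` is finite dimensional for some `n`. -/
def IsFinitePotent {k V : Type*} [Field k] [AddCommGroup V] [Module k V]
    (φ : Module.End k V) : Prop :=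
  ∃ n : ℕ, FiniteDimensional k (LinearMap.range (φ ^ n))

/-- The index of `φ`: the least `m` with `ker (φ^m) = ker (φ^(m+1))`. -/
noncomputable def endIndex {k V : Type*} [Field k] [AddCommGroup V] [Module k V]
    (φ : Module.End k V) : ℕ :=
  sInf {m : ℕ | LinearMap.ker (φ ^ m) = LinearMap.ker (φ ^ (m + 1))}

/-- The minus order: `φ ≤⁻ ψ`. -/
def MinusLe {k V : Type*} [Field k] [AddCommGroup V] [Module k V]
    (φ ψ : Module.End k V) : Prop :=
  ∃ h : Module.End k V, IsOneInv φ h ∧ h * φ = h * ψ ∧ φ * h = ψ * h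

/-- The GD1 relation `φ ≤^{GD1} ψ` (with `m` the index of `φ`). -/
def GD1Le {k V : Type*} [Field k] [AddCommGroup V] [Module k V]
    (φ : Module.End k V) (m : ℕ) (ψ : Module.End k V) : Prop :=
  ∃ τ : Module.End k V, IsGD1 φ m τ ∧ φ * τ = ψ * τ ∧ τ * φ = τ * ψ

/-- The 1GD relation `φ ≤^{1GD} ψ` (with `m` the index of `φ`). -/
def OneGDLe {k V : Type*} [Field k] [AddCommGroup V] [Module k V]
    (φ : Module.End k V) (m : ℕ) (ψ : Module.End k V) : Prop :=
  ∃ τ : Module.End k V, Is1GD φ m τ ∧ φ * τ = ψ * τ ∧ τ * φ = τ * ψ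

theorem stmt0 {k V : Type*} [Field k] [AddCommGroup V] [Module k V]
    (φ h g : Module.End k V) (m : ℕ) (hm : 0 < m)
    (hh : IsOneInv φ h) (hg : IsGDrazin φ m g) :
    ((g * φ * h) * φ * (g * φ * h) = g * φ * h ∧
      (g * φ * h) * φ = g * φ ∧ φ * (g * φ * h) = φ * h) ∧
    ∀ ψ : Module.End k V,
      (ψ * φ * ψ = ψ ∧ ψ * φ = g * φ ∧ φ * ψ = φ * h) → ψ = g * φ * h := by
  have h_left : (g * φ * h) * φ = g * φ := by
    rw [mul_assoc, mul_assoc, ← mul_assoc φ h φ, hh]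
  have h_right : φ * (g * φ * h) = φ * h := by
    rw [← mul_assoc, ← mul_assoc, hg.1]
  refine ⟨⟨?_, h_left, h_right⟩, ?_⟩
  · rw [h_left, mul_assoc, h_right, mul_assoc]
  · rintro ψ ⟨hψ, hψ_left, hψ_right⟩
    rw [← hψ, hψ_left, mul_assoc, hψ_right, mul_assoc]
end

section
/- Let φ ∈ End(V) admit an AST decomposition with subspaces W, U and index m. An endomorphism ψ ∈ End(V) is a GD1 inverse of φ if and only if ψ = g∘φ∘h for some G-Drazin inverse g of φ and some {1}-inverse h of φ. -/
theorem stmt1 {k V : Type*} [Field k] [AddCommGroup V] [Module k V]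
    (φ : Module.End k V) (W U : Submodule k V) (m : ℕ)
    (hAST : IsAST φ W U m) (ψ : Module.End k V) :
    IsGD1 φ m ψ ↔ ∃ g h : Module.End k V,
      IsGDrazin φ m g ∧ IsOneInv φ h ∧ ψ = g * φ * h := by
  constructor
  · rintro ⟨hψ, g, h, hg, hh, hl, hr⟩
    exact ⟨g, h, hg, hh, by rw [mul_assoc, ← hr, ← mul_assoc, ← hl, hψ]⟩
  · rintro ⟨g, h, hg, hh, rfl⟩
    have hl : g * φ * h * φ = g * φ := by
      rw [mul_assoc g, mul_assoc g, hh]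
    have hr : φ * (g * φ * h) = φ * h := by
      rw [← mul_assoc, ← mul_assoc, hg.1]
    exact ⟨by rw [mul_assoc, hr, ← mul_assoc, hl], g, h, hg, hh, hl, hr⟩
end

section
/- Let φ ∈ End(V) admit an AST decomposition with subspaces W, U and index m. An endomorphism ψ ∈ End(V) is a GD1 inverse of φ if and only if ψ is a {1,2}-inverse of φ and ψ leaves W invariant, i.e. ψ(W) ⊆ W. -/
section

variable {k V : Type*} [Field k] [AddCommGroup V] [Module k V]
  {φ ψ : Module.End k V} {W U : Submodule k V} {m : ℕ}

theorem bijOn_pow_of_isAST (h : IsAST φ W U m) (n : ℕ) :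
    Set.BijOn (⇑(φ ^ n)) (W : Set V) (W : Set V) := by
  rw [Module.End.coe_pow]
  exact h.2.2.2.2.1.iterate n

theorem exists_add_of_isAST (h : IsAST φ W U m) (v : V) :
    ∃ w ∈ W, ∃ u ∈ U, w + u = v :=
  Submodule.mem_sup.1 (h.1.sup_eq_top ▸ Submodule.mem_top)

theorem mem_iff_exists_pow_apply_of_isAST (h : IsAST φ W U m) (w : V) :
    w ∈ W ↔ ∃ v, (φ ^ m) v = w := by
  constructor
  · intro hw
    obtain ⟨v, -, hv⟩ := (bijOn_pow_of_isAST h m).surjOn hw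
    exact ⟨v, hv⟩
  · rintro ⟨v, rfl⟩
    obtain ⟨w, hw, u, hu, rfl⟩ := exists_add_of_isAST h v
    rw [map_add, h.2.2.2.2.2.1 u hu, add_zero]
    exact (bijOn_pow_of_isAST h m).mapsTo hw

theorem ker_le_of_isAST (h : IsAST φ W U m) : LinearMap.ker φ ≤ U := by
  intro v hv
  obtain ⟨w, hw, u, hu, rfl⟩ := exists_add_of_isAST h v
  rw [LinearMap.mem_ker, map_add] at hv
  have h0 : φ w = 0 := by
    refine Submodule.disjoint_def.1 h.1.disjoint _ (h.2.1 w hw) ?_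
    rw [eq_neg_of_add_eq_zero_left hv]
    exact U.neg_mem (h.2.2.1 u hu)
  have hw0 : w = 0 := h.2.2.2.2.1.injOn hw W.zero_mem (by rw [h0, map_zero])
  simpa [hw0] using hu

/-- On the core `W`, a `{1}`-inverse preserving `W` is a left inverse of `φ`. -/
theorem oneInv_apply_apply_of_isAST (h : IsAST φ W U m) (hψ : φ * ψ * φ = φ)
    (hW : ∀ w ∈ W, ψ w ∈ W) {w : V} (hw : w ∈ W) : ψ (φ w) = w :=
  h.2.2.2.2.1.injOn (hW _ (h.2.1 w hw)) hw (LinearMap.congr_fun hψ w)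

theorem oneInv_pow_apply_comm_of_isAST (h : IsAST φ W U m) (hψ : φ * ψ * φ = φ)
    (hW : ∀ w ∈ W, ψ w ∈ W) (n : ℕ) {w : V} (hw : w ∈ W) :
    ψ ((φ ^ n) w) = (φ ^ n) (ψ w) := by
  obtain ⟨x, hx, rfl⟩ := h.2.2.2.2.1.surjOn hw
  rw [oneInv_apply_apply_of_isAST h hψ hW hx, ← Module.End.mul_apply (φ ^ n) φ, ← pow_succ, pow_succ',
    Module.End.mul_apply,
    oneInv_apply_apply_of_isAST h hψ hW ((bijOn_pow_of_isAST h n).mapsTo hx)]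

/-- A `{1}`-inverse preserving `W` agrees on the range of `φ` with a G-Drazin inverse. -/
theorem exists_isGDrazin_mul_eq_of_isAST (h : IsAST φ W U m) (hψ : φ * ψ * φ = φ)
    (hW : ∀ w ∈ W, ψ w ∈ W) : ∃ g, IsGDrazin φ m g ∧ ψ * φ = g * φ := by
  let p : Module.End k V := U.projection W h.1.symm
  have hpU : ∀ v, p v ∈ U := fun v => Submodule.projection_apply_mem _ v
  have hpW : ∀ w ∈ W, p w = 0 := fun w hw =>
    (Submodule.projection_apply_eq_zero_iff _).2 hw
  have hpu : ∀ u ∈ U, p u = u := fun u hu =>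
    Submodule.projection_apply_left _ ⟨u, hu⟩
  let g : Module.End k V := ψ * (1 - p) + p * ψ * p
  have hgW : ∀ w ∈ W, g w = ψ w := fun w hw => by simp [g, hpW w hw]
  have hgU : ∀ u ∈ U, g u = p (ψ u) := fun u hu => by simp [g, hpu u hu]
  have hg : ψ * φ = g * φ := by
    ext v
    obtain ⟨w, hw, u, hu, rfl⟩ := exists_add_of_isAST h v
    have hmem : ψ (φ u) ∈ U := by
      have hker : ψ (φ u) - u ∈ LinearMap.ker φ := by
        rw [LinearMap.mem_ker, map_sub, sub_eq_zero]
        exact LinearMap.congr_fun hψ u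
      simpa using U.add_mem (ker_le_of_isAST h hker) hu
    simp only [Module.End.mul_apply, map_add]
    rw [hgW _ (h.2.1 w hw), hgU _ (h.2.2.1 u hu), hpu _ hmem]
  refine ⟨g, ⟨by rw [mul_assoc, ← hg, ← mul_assoc, hψ], ?_⟩, hg⟩
  ext v
  obtain ⟨w, hw, u, hu, rfl⟩ := exists_add_of_isAST h v
  have hzero := h.2.2.2.2.2.1
  simp only [Module.End.mul_apply, map_add]
  rw [hgW _ ((bijOn_pow_of_isAST h m).mapsTo hw), hgW w hw, hgU u hu, hzero u hu,
    hzero _ (hpU _), oneInv_pow_apply_comm_of_isAST h hψ hW m hw, map_zero]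

theorem isGDrazin_apply_mem_of_isAST (h : IsAST φ W U m) {g : Module.End k V}
    (hg : IsGDrazin φ m g) {w : V} (hw : w ∈ W) : g w ∈ W := by
  obtain ⟨v, rfl⟩ := (mem_iff_exists_pow_apply_of_isAST h w).1 hw
  exact (mem_iff_exists_pow_apply_of_isAST h _).2 ⟨g v, (LinearMap.congr_fun hg.2 v).symm⟩

end

theorem stmt3 {k V : Type*} [Field k] [AddCommGroup V] [Module k V]
    (φ : Module.End k V) (W U : Submodule k V) (m : ℕ)
    (hAST : IsAST φ W U m) (ψ : Module.End k V) :
    IsGD1 φ m ψ ↔ (φ * ψ * φ = φ ∧ ψ * φ * ψ = ψ) ∧ ∀ w ∈ W, ψ w ∈ W := by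
  constructor
  · rintro ⟨hψ, g, -, hg, -, hgφ, -⟩
    refine ⟨⟨by rw [mul_assoc, hgφ, ← mul_assoc, hg.1], hψ⟩, fun w hw => ?_⟩
    obtain ⟨x, -, rfl⟩ := hAST.2.2.2.2.1.surjOn hw
    have hx : ψ (φ x) = g (φ x) := LinearMap.congr_fun hgφ x
    exact hx ▸ isGDrazin_apply_mem_of_isAST hAST hg hw
  · rintro ⟨⟨h₁, h₂⟩, hW⟩
    obtain ⟨g, hg, hgφ⟩ := exists_isGDrazin_mul_eq_of_isAST hAST h₁ hW
    exact ⟨h₂, g, ψ, hg, h₁, hgφ, rfl⟩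
end

section
/- Let φ ∈ End(V) admit an AST decomposition with subspaces W, U and index m. An endomorphism ψ ∈ End(V) is a 1GD inverse of φ if and only if ψ = h∘φ∘g for some {1}-inverse h of φ and some G-Drazin inverse g of φ. -/
theorem stmt4 {k V : Type*} [Field k] [AddCommGroup V] [Module k V]
    (φ : Module.End k V) (W U : Submodule k V) (m : ℕ)
    (hAST : IsAST φ W U m) (ψ : Module.End k V) :
    Is1GD φ m ψ ↔ ∃ h g : Module.End k V,
      IsOneInv φ h ∧ IsGDrazin φ m g ∧ ψ = h * φ * g := by
  constructor
  · rintro ⟨hψ, h, g, hh, hg, hl, hr⟩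
    refine ⟨h, g, hh, hg, ?_⟩
    rw [mul_assoc, ← hr, ← mul_assoc, ← hl, hψ]
  · rintro ⟨h, g, hh, hg, rfl⟩
    have hl : h * φ * g * φ = h * φ := by
      rw [mul_assoc, mul_assoc, ← mul_assoc φ, hg.1]
    have hr : φ * (h * φ * g) = φ * g := by
      rw [← mul_assoc, ← mul_assoc, hh]
    refine ⟨?_, h, g, hh, hg, hl, hr⟩
    rw [mul_assoc _ φ, hr, ← mul_assoc, hl]
end

section
/- Let φ ∈ End(V) admit an AST decomposition with subspaces W, U and index m. An endomorphism ψ ∈ End(V) is a 1GD inverse of φ if and only if ψ is a {1,2}-inverse of φ and ψ leaves U invariant, i.e. ψ(U) ⊆ U. -/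
section

variable {k V : Type*} [Field k] [AddCommGroup V] [Module k V]
  {φ : Module.End k V} {W U : Submodule k V} {m : ℕ}

namespace IsAST

theorem mem_of_apply_mem (hAST : IsAST φ W U m) {x : V} (hx : φ x ∈ U) : x ∈ U := by
  obtain ⟨hc, hW, hU, -, hb, -⟩ := hAST
  obtain ⟨w, u, hw, hu, rfl⟩ := Submodule.codisjoint_iff_exists_add_eq.mp hc.codisjoint x
  have hφw : φ w = 0 := by
    refine Submodule.disjoint_def.mp hc.disjoint _ (hW w hw) ?_
    rw [map_add] at hx
    exact (U.add_mem_iff_left (hU u hu)).mp hx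
  have hw0 : w = 0 := hb.injOn hw W.zero_mem (by rw [hφw, map_zero])
  simpa [hw0] using hu

theorem mem_iff_pow_apply_eq_zero (hAST : IsAST φ W U m) {x : V} :
    x ∈ U ↔ (φ ^ m) x = 0 := by
  refine ⟨hAST.2.2.2.2.2.1 x, fun hx => ?_⟩
  have key : ∀ n : ℕ, ∀ y : V, (φ ^ n) y ∈ U → y ∈ U := by
    intro n
    induction n with
    | zero => simp
    | succ n ih =>
      intro y hy
      rw [pow_succ, Module.End.mul_apply] at hy
      exact hAST.mem_of_apply_mem (ih _ hy)
  exact key m x (hx ▸ U.zero_mem)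

/-- A {1}-inverse leaving `U` invariant can be modified on `W` to a G-Drazin inverse,
without changing its composite with `φ`. -/
theorem exists_isGDrazin (hAST : IsAST φ W U m) {ψ : Module.End k V}
    (hψ : φ * ψ * φ = φ) (hψU : ∀ u ∈ U, ψ u ∈ U) :
    ∃ g : Module.End k V, IsGDrazin φ m g ∧ φ * ψ = φ * g := by
  have hpow : ∀ x, x ∈ U → (φ ^ m) x = 0 := fun x => hAST.mem_iff_pow_apply_eq_zero.mp
  obtain ⟨hc, hW, -, -, hb, -⟩ := hAST
  let e : W ≃ₗ[k] W := LinearEquiv.ofBijective (φ.restrict hW) hb.bijective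
  have he : ∀ w : W, (e w : V) = φ w := fun _ => rfl
  let g : Module.End k V :=
    LinearMap.ofIsCompl hc (W.subtype ∘ₗ e.symm.toLinearMap) (ψ.domRestrict U)
  have hgW : ∀ w : W, g w = e.symm w := fun w => LinearMap.ofIsCompl_apply_left hc w
  have hgU : ∀ u : U, g u = ψ u := fun u => LinearMap.ofIsCompl_apply_right hc u
  have hext : ∀ {f f' : Module.End k V}, (∀ w : W, f w = f' w) → (∀ u : U, f u = f' u) →
      f = f' := by
    intro f f' h₁ h₂
    ext x
    obtain ⟨w, u, hw, hu, rfl⟩ := Submodule.codisjoint_iff_exists_add_eq.mp hc.codisjoint x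
    rw [map_add, map_add, h₁ ⟨w, hw⟩, h₂ ⟨u, hu⟩]
  have hφg : φ * ψ = φ * g := by
    refine hext (fun w => ?_) (fun u => by simp [hgU])
    obtain ⟨w, rfl⟩ := e.surjective w
    rw [Module.End.mul_apply, Module.End.mul_apply, hgW, e.symm_apply_apply, he]
    exact LinearMap.congr_fun hψ w
  have hcomm : ∀ n : ℕ, ∀ w : W, g ((φ ^ n) w) = (φ ^ n) (g w) := by
    intro n
    induction n with
    | zero => simp
    | succ n ih =>
      intro w
      rw [pow_succ, Module.End.mul_apply, Module.End.mul_apply, ← he, ih, hgW, hgW, ← he,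
        e.symm_apply_apply, e.apply_symm_apply]
  refine ⟨g, ⟨by rw [← hφg, hψ], hext (hcomm m) fun u => ?_⟩, hφg⟩
  rw [Module.End.mul_apply, Module.End.mul_apply, hpow u u.2, map_zero, hgU,
    hpow _ (hψU u u.2)]

end IsAST

end

theorem stmt5 {k V : Type*} [Field k] [AddCommGroup V] [Module k V]
    (φ : Module.End k V) (W U : Submodule k V) (m : ℕ)
    (hAST : IsAST φ W U m) (ψ : Module.End k V) :
    Is1GD φ m ψ ↔ (φ * ψ * φ = φ ∧ ψ * φ * ψ = ψ) ∧ ∀ u ∈ U, ψ u ∈ U := by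
  constructor
  · rintro ⟨h2, h, g, h1, ⟨-, hg⟩, hl, hr⟩
    refine ⟨⟨by rw [mul_assoc, hl, ← mul_assoc, h1], h2⟩, fun u hu => ?_⟩
    have hgu : g u ∈ U := by
      rw [hAST.mem_iff_pow_apply_eq_zero, ← Module.End.mul_apply, ← hg, Module.End.mul_apply,
        hAST.mem_iff_pow_apply_eq_zero.mp hu, map_zero]
    apply hAST.mem_of_apply_mem
    rw [← Module.End.mul_apply, hr]
    exact hAST.2.2.1 _ hgu
  · rintro ⟨⟨h1, h2⟩, hU⟩
    obtain ⟨g, hg, hr⟩ := hAST.exists_isGDrazin h1 hU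
    exact ⟨h2, ψ, g, h1, hg, rfl, hr⟩
end

section
/- Let φ ∈ End(V) admit an AST decomposition with subspaces W, U and index m. Then for every 1GD inverse ψ of φ one has φ^{m+1}∘ψ = φ^m. -/
/-- Under an AST decomposition of index `m`, the range of `φ ^ m` lies in the range of `φ`. -/
theorem IsAST.exists_pow_apply_eq {k V : Type*} [Field k] [AddCommGroup V] [Module k V]
    {φ : Module.End k V} {W U : Submodule k V} {m : ℕ} (hAST : IsAST φ W U m) (v : V) :
    ∃ x, (φ ^ m) v = φ x := by
  obtain ⟨hWU, -, -, -, hbij, hm, -⟩ := hAST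
  obtain ⟨w, hw, u, hu, rfl⟩ := Submodule.mem_sup.mp (hWU.sup_eq_top ▸ Submodule.mem_top (x := v))
  obtain ⟨w', -, rfl⟩ := hbij.surjOn hw
  refine ⟨(φ ^ m) w', ?_⟩
  rw [map_add, hm u hu, add_zero, ← Module.End.mul_apply, ← pow_succ, pow_succ',
    Module.End.mul_apply]

theorem stmt6 {k V : Type*} [Field k] [AddCommGroup V] [Module k V]
    (φ : Module.End k V) (W U : Submodule k V) (m : ℕ)
    (hAST : IsAST φ W U m) (ψ : Module.End k V) (hψ : Is1GD φ m ψ) :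
    φ ^ (m + 1) * ψ = φ ^ m := by
  obtain ⟨-, -, g, -, ⟨hg, hcomm⟩, -, hψg⟩ := hψ
  have key : φ ^ (m + 1) * ψ = φ * g * φ ^ m := by
    rw [pow_succ, mul_assoc, hψg, ← mul_assoc, ← pow_succ, pow_succ', mul_assoc, ← hcomm,
      ← mul_assoc]
  rw [key]
  ext v
  obtain ⟨x, hx⟩ := hAST.exists_pow_apply_eq v
  rw [Module.End.mul_apply, hx, ← Module.End.mul_apply, hg]
end

section
/- Let φ ∈ End(V) admit an AST decomposition with subspaces W, U and index m. If ψ₁ and ψ₂ are GD1 inverses of φ, then ψ₁∘φ∘ψ₂ is again a GD1 inverse of φ; consequently, the map sending a pair of GD1 inverses (ψ₁, ψ₂) to ψ₁∘φ∘ψ₂ is a surjection from X_φ(GD1) × X_φ(GD1) onto X_φ(GD1), i.e. every GD1 inverse of φ arises in this way. -/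
theorem stmt7 {k V : Type*} [Field k] [AddCommGroup V] [Module k V]
    (φ : Module.End k V) (W U : Submodule k V) (m : ℕ)
    (hAST : IsAST φ W U m) :
    (∀ ψ₁ ψ₂ : Module.End k V, IsGD1 φ m ψ₁ → IsGD1 φ m ψ₂ →
      IsGD1 φ m (ψ₁ * φ * ψ₂)) ∧
    (∀ ψ : Module.End k V, IsGD1 φ m ψ →
      ∃ ψ₁ ψ₂ : Module.End k V, IsGD1 φ m ψ₁ ∧ IsGD1 φ m ψ₂ ∧ ψ₁ * φ * ψ₂ = ψ) := by
  have {ψ : Module.End k V} (hψ : IsGD1 φ m ψ) : φ * ψ * φ = φ := by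
    obtain ⟨-, g, -, hg, -, hgφ, -⟩ := hψ
    rw [mul_assoc, hgφ, ← mul_assoc, hg.1]
  refine ⟨fun ψ₁ ψ₂ h₁ h₂ => ?_, fun ψ hψ => ⟨ψ, ψ, hψ, hψ, hψ.1⟩⟩
  have e₁ := this h₁
  have e₂ := this h₂
  obtain ⟨-, g, -, hg, -, hgφ, -⟩ := h₁
  obtain ⟨-, -, h, -, hh, -, hφh⟩ := h₂
  have left : ψ₁ * φ * ψ₂ * φ = ψ₁ * φ := by
    rw [mul_assoc ψ₁, mul_assoc ψ₁, e₂]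
  have right : φ * (ψ₁ * φ * ψ₂) = φ * ψ₂ := by
    rw [← mul_assoc, ← mul_assoc, e₁]
  refine ⟨?_, g, h, hg, hh, left.trans hgφ, right.trans hφh⟩
  rw [left, mul_assoc ψ₁ φ (ψ₁ * φ * ψ₂), right, mul_assoc]
end

section
/- Let φ ∈ End(V) admit an AST decomposition with subspaces W, U and index m, and let S be a φ-invariant subspace of V. If φ restricted to S is an automorphism of S (φ maps S bijectively onto S), then S ⊆ W, and in particular S is finite-dimensional. If instead φ restricted to S is nilpotent (φ^n(S) = 0 for some n), then S ⊆ U. -/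
theorem stmt8 {k V : Type*} [Field k] [AddCommGroup V] [Module k V]
    (φ : Module.End k V) (W U : Submodule k V) (m : ℕ)
    (hAST : IsAST φ W U m) (S : Submodule k V) (hS : ∀ s ∈ S, φ s ∈ S) :
    (Set.BijOn (⇑φ) (S : Set V) (S : Set V) → S ≤ W ∧ FiniteDimensional k S) ∧
    ((∃ n : ℕ, ∀ s ∈ S, (φ ^ n) s = 0) → S ≤ U) := by
  obtain ⟨hc, -, -, hfin, hW, hm, -⟩ := hAST
  have hWpow (n : ℕ) : Set.BijOn (⇑(φ ^ n)) (W : Set V) (W : Set V) := by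
    rw [Module.End.coe_pow]
    exact hW.iterate n
  have hsplit (v : V) : ∃ w ∈ W, ∃ u ∈ U, w + u = v :=
    Submodule.mem_sup.mp (hc.sup_eq_top ▸ Submodule.mem_top)
  refine ⟨fun hbij => ?_, fun ⟨n, hn⟩ s hs => ?_⟩
  · have hle : S ≤ W := by
      intro s hs
      have hSpow : Set.BijOn (⇑(φ ^ m)) (S : Set V) (S : Set V) := by
        rw [Module.End.coe_pow]
        exact hbij.iterate m
      obtain ⟨t, -, rfl⟩ := hSpow.surjOn hs
      obtain ⟨w, hw, u, hu, rfl⟩ := hsplit t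
      rw [map_add, hm u hu, add_zero]
      exact (hWpow m).mapsTo hw
    exact ⟨hle, Submodule.finiteDimensional_of_le hle⟩
  · obtain ⟨w, hw, u, hu, rfl⟩ := hsplit s
    have hu0 : (φ ^ (n + m)) u = 0 := by
      rw [pow_add, Module.End.mul_apply, hm u hu, map_zero]
    have hs0 : (φ ^ (n + m)) (w + u) = 0 := by
      rw [add_comm n m, pow_add, Module.End.mul_apply, hn _ hs, map_zero]
    rw [map_add, hu0, add_zero] at hs0
    have hw0 : w = 0 :=
      (hWpow (n + m)).injOn hw W.zero_mem (hs0.trans (map_zero _).symm)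
    rwa [hw0, zero_add]
end

section
/- Let φ, ψ ∈ End(V) with φ admitting an AST decomposition with subspaces W, U and index m, and ψ finite potent. The following are equivalent: (I) φ ≤^{GD1} ψ; (II) φ = φ∘h∘ψ = ψ∘g∘φ for some {1}-inverse h of φ and some G-Drazin inverse g of φ; (III) φ = φ∘τ∘ψ = ψ∘τ∘φ for some GD1 inverse τ of φ. -/
section EndLemmas

variable {k V : Type*} [Field k] [AddCommGroup V] [Module k V]
  {φ ψ g h τ : Module.End k V} {m : ℕ}

/-- `g∘φ∘h` is a GD1 inverse, for a G-Drazin inverse `g` and a `{1}`-inverse `h`. -/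
theorem IsGDrazin.isGD1_mul_mul (hg : IsGDrazin φ m g) (hh : IsOneInv φ h) :
    IsGD1 φ m (g * φ * h) := by
  have hτφ : g * φ * h * φ = g * φ := by
    calc g * φ * h * φ = g * (φ * h * φ) := by noncomm_ring
      _ = g * φ := by rw [hh]
  have hφτ : φ * (g * φ * h) = φ * h := by
    calc φ * (g * φ * h) = φ * g * φ * h := by noncomm_ring
      _ = φ * h := by rw [hg.1]
  refine ⟨?_, g, h, hg, hh, hτφ, hφτ⟩
  rw [hτφ, mul_assoc, hφτ, mul_assoc]

theorem IsGD1.mul_mul_self (hτ : IsGD1 φ m τ) : φ * τ * φ = φ := by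
  obtain ⟨-, g, h, -, hh, -, hφτ⟩ := hτ
  rw [hφτ, hh]

theorem gd1Le_iff_exists_isGD1 :
    GD1Le φ m ψ ↔ ∃ τ : Module.End k V,
      IsGD1 φ m τ ∧ φ = φ * τ * ψ ∧ φ = ψ * τ * φ := by
  refine exists_congr fun τ => and_congr_right fun hτ => ⟨?_, ?_⟩
  · rintro ⟨h₁, h₂⟩
    exact ⟨by rw [mul_assoc, ← h₂, ← mul_assoc, hτ.mul_mul_self],
      by rw [← h₁, hτ.mul_mul_self]⟩
  · rintro ⟨h₁, h₂⟩
    constructor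
    · calc φ * τ = ψ * τ * φ * τ := by rw [← h₂]
        _ = ψ * (τ * φ * τ) := by noncomm_ring
        _ = ψ * τ := by rw [hτ.1]
    · calc τ * φ = τ * (φ * τ * ψ) := by rw [← h₁]
        _ = τ * φ * τ * ψ := by noncomm_ring
        _ = τ * ψ := by rw [hτ.1]

theorem exists_isGD1_iff_exists_isOneInv_isGDrazin :
    (∃ τ : Module.End k V, IsGD1 φ m τ ∧ φ = φ * τ * ψ ∧ φ = ψ * τ * φ) ↔
      ∃ h g : Module.End k V,
        IsOneInv φ h ∧ IsGDrazin φ m g ∧ φ = φ * h * ψ ∧ φ = ψ * g * φ := by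
  constructor
  · rintro ⟨τ, ⟨-, g, h, hg, hh, hτφ, hφτ⟩, h₁, h₂⟩
    exact ⟨h, g, hh, hg, by rwa [← hφτ], by rwa [mul_assoc, ← hτφ, ← mul_assoc]⟩
  · rintro ⟨h, g, hh, hg, h₁, h₂⟩
    refine ⟨g * φ * h, hg.isGD1_mul_mul hh, ?_, ?_⟩
    · calc φ = φ * h * ψ := h₁
        _ = φ * g * φ * h * ψ := by rw [hg.1]
        _ = φ * (g * φ * h) * ψ := by noncomm_ring
    · calc φ = ψ * g * φ := h₂
        _ = ψ * g * (φ * h * φ) := by rw [hh]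
        _ = ψ * (g * φ * h) * φ := by noncomm_ring

end EndLemmas

theorem stmt9 {k V : Type*} [Field k] [AddCommGroup V] [Module k V]
    (φ ψ : Module.End k V) (W U : Submodule k V) (m : ℕ)
    (hAST : IsAST φ W U m) (hψ : IsFinitePotent ψ) :
    (GD1Le φ m ψ ↔ ∃ h g : Module.End k V,
        IsOneInv φ h ∧ IsGDrazin φ m g ∧ φ = φ * h * ψ ∧ φ = ψ * g * φ) ∧
    (GD1Le φ m ψ ↔ ∃ τ : Module.End k V,
        IsGD1 φ m τ ∧ φ = φ * τ * ψ ∧ φ = ψ * τ * φ) := by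
  exact ⟨gd1Le_iff_exists_isGD1.trans exists_isGD1_iff_exists_isOneInv_isGDrazin,
    gd1Le_iff_exists_isGD1⟩
end

section
/- Let φ, ψ ∈ End(V) with φ admitting an AST decomposition with subspaces W, U and index m, and ψ finite potent. If φ ≤^{GD1} ψ, then φ ≤^- ψ (minus order), and moreover φ is below ψ in the space pre-order: range(φ) ⊆ range(ψ) and ker(ψ) ⊆ ker(φ). -/
theorem stmt10 {k V : Type*} [Field k] [AddCommGroup V] [Module k V]
    (φ ψ : Module.End k V) (W U : Submodule k V) (m : ℕ)
    (hAST : IsAST φ W U m) (hψ : IsFinitePotent ψ) (hle : GD1Le φ m ψ) :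
    MinusLe φ ψ ∧ LinearMap.range φ ≤ LinearMap.range ψ ∧
      LinearMap.ker ψ ≤ LinearMap.ker φ := by
  obtain ⟨τ, ⟨-, g, h, hg, -, hτg, -⟩, hleft, hright⟩ := hle
  have hone : φ * τ * φ = φ := by rw [mul_assoc, hτg, ← mul_assoc, hg.1]
  refine ⟨⟨τ, hone, hright, hleft⟩, ?_, ?_⟩
  · rintro _ ⟨x, rfl⟩
    refine ⟨τ (φ x), ?_⟩
    have hφ : ψ * τ * φ = φ := by rw [← hleft, hone]
    exact LinearMap.congr_fun hφ x
  · intro x hx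
    have hφ : φ * τ * ψ = φ := by rw [mul_assoc, ← hright, ← mul_assoc, hone]
    rw [LinearMap.mem_ker] at hx ⊢
    rw [← hφ, Module.End.mul_apply, hx, map_zero]
end

section
/- Let φ, ψ ∈ End(V) with φ admitting an AST decomposition with subspaces W, U and index m, and ψ finite potent. If φ ≤^{GD1} ψ, then φ and ψ coincide on W (φ(w) = ψ(w) for all w ∈ W); in particular W is ψ-invariant, φ^{m+1} = ψ∘φ^m, and W ⊆ range(ψ). -/
/-- In an AST decomposition of index `m`, the range of `φ ^ m` is `W`. -/
theorem IsAST.range_pow {k V : Type*} [Field k] [AddCommGroup V] [Module k V]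
    {φ : Module.End k V} {W U : Submodule k V} {m : ℕ} (h : IsAST φ W U m) :
    LinearMap.range (φ ^ m) = W := by
  obtain ⟨hc, -, -, -, hbij, hm, -⟩ := h
  have hpow : Set.BijOn (⇑(φ ^ m)) (W : Set V) (W : Set V) := by
    rw [Module.End.coe_pow]
    exact hbij.iterate m
  ext v
  constructor
  · rintro ⟨x, rfl⟩
    obtain ⟨w, hw, u, hu, rfl⟩ :=
      Submodule.mem_sup.mp (hc.sup_eq_top ▸ Submodule.mem_top : x ∈ W ⊔ U)
    rw [map_add, hm u hu, add_zero]
    exact hpow.mapsTo hw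
  · intro hv
    obtain ⟨x, -, hx⟩ := hpow.surjOn hv
    exact ⟨x, hx⟩

/-- A G-Drazin inverse of `φ` is a left inverse of `φ` on the core `W`. -/
theorem IsGDrazin.apply_apply_of_mem {k V : Type*} [Field k] [AddCommGroup V] [Module k V]
    {φ g : Module.End k V} {W U : Submodule k V} {m : ℕ} (hAST : IsAST φ W U m)
    (hg : IsGDrazin φ m g) {w : V} (hw : w ∈ W) : g (φ w) = w := by
  have hgW : ∀ x ∈ W, g x ∈ W := by
    rw [← hAST.range_pow]
    rintro _ ⟨y, rfl⟩
    exact ⟨g y, (LinearMap.congr_fun hg.2 y).symm⟩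
  have hinv : ∀ w ∈ W, φ w ∈ W := hAST.2.1
  have hbij : Set.BijOn (⇑φ) (W : Set V) (W : Set V) := hAST.2.2.2.2.1
  exact hbij.injOn (hgW _ (hinv w hw)) hw (LinearMap.congr_fun hg.1 w)

theorem stmt11 {k V : Type*} [Field k] [AddCommGroup V] [Module k V]
    (φ ψ : Module.End k V) (W U : Submodule k V) (m : ℕ)
    (hAST : IsAST φ W U m) (hψ : IsFinitePotent ψ) (hle : GD1Le φ m ψ) :
    (∀ w ∈ W, φ w = ψ w) ∧ (∀ w ∈ W, ψ w ∈ W) ∧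
      φ ^ (m + 1) = ψ * φ ^ m ∧ W ≤ LinearMap.range ψ := by
  obtain ⟨τ, ⟨-, g, h, hg, -, hτg, -⟩, hτ, -⟩ := hle
  have hinv : ∀ w ∈ W, φ w ∈ W := hAST.2.1
  have heq : ∀ w ∈ W, φ w = ψ w := fun w hw => by
    have hτw : τ (φ w) = w :=
      (LinearMap.congr_fun hτg w).trans (hg.apply_apply_of_mem hAST hw)
    have := LinearMap.congr_fun hτ (φ w)
    simpa only [Module.End.mul_apply, hτw] using this
  refine ⟨heq, fun w hw => heq w hw ▸ hinv w hw, ?_, fun w hw => ?_⟩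
  · ext v
    rw [pow_succ']
    exact heq _ (hAST.range_pow ▸ LinearMap.mem_range_self (φ ^ m) v)
  · obtain ⟨x, hx, rfl⟩ := hAST.2.2.2.2.1.surjOn hw
    exact ⟨x, (heq x hx).symm⟩
end

section
/- Let φ, ψ ∈ End(V), where φ admits an AST decomposition with subspaces W_φ, U_φ and index m, and ψ is finite potent. Then φ ≤^{GD1} ψ if and only if both: (I) φ and ψ coincide on W_φ (φ(w) = ψ(w) for all w ∈ W_φ), and (II) φ ≤^- ψ (minus order). -/
section

variable {k V : Type*} [Field k] [AddCommGroup V] [Module k V]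
  {φ ψ : Module.End k V} {W U : Submodule k V} {m : ℕ}

/-- The projection onto the first summand of an AST decomposition, along the second one. -/
theorem IsAST.exists_projection (hφ : IsAST φ W U m) :
    ∃ P : Module.End k V, (∀ x, P x ∈ W) ∧ (∀ w ∈ W, P w = w) ∧ (∀ x, P (φ x) = φ (P x)) ∧
      (∀ x, (φ ^ m) (P x) = (φ ^ m) x) := by
  obtain ⟨hc, hW, hU, -, -, hm, -⟩ := hφ
  have hPW : ∀ w ∈ W, W.projection U hc w = w := fun w hw =>
    Submodule.projection_apply_left hc ⟨w, hw⟩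
  have hPU : ∀ u ∈ U, W.projection U hc u = 0 := fun u hu =>
    (Submodule.projection_apply_eq_zero_iff hc).mpr hu
  have hsplit : ∀ x : V, ∃ w ∈ W, ∃ u ∈ U, w + u = x := fun x =>
    Submodule.mem_sup.mp (hc.sup_eq_top ▸ Submodule.mem_top)
  refine ⟨W.projection U hc, fun x => ?_, hPW, fun x => ?_, fun x => ?_⟩ <;>
    obtain ⟨w, hw, u, hu, rfl⟩ := hsplit x
  · simpa [hPW w hw, hPU u hu] using hw
  · simp [hPW w hw, hPU u hu, hPW _ (hW w hw), hPU _ (hU u hu)]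
  · simp [hPW w hw, hPU u hu, hm u hu]

theorem IsAST.pow_mem (hφ : IsAST φ W U m) (n : ℕ) : ∀ w ∈ W, (φ ^ n) w ∈ W := by
  induction n with
  | zero => exact fun w hw => hw
  | succ n ih => exact fun w hw => by simpa [pow_succ] using ih _ (hφ.2.1 w hw)

theorem IsAST.exists_pow_eq (hφ : IsAST φ W U m) (n : ℕ) :
    ∀ w ∈ W, ∃ v ∈ W, (φ ^ n) v = w := by
  induction n with
  | zero => exact fun w hw => ⟨w, hw, rfl⟩
  | succ n ih =>
    intro w hw
    obtain ⟨v, hv, rfl⟩ := ih w hw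
    obtain ⟨v', hv', rfl⟩ := hφ.2.2.2.2.1.surjOn hv
    exact ⟨v', hv', by simp [pow_succ]⟩

/-- A G-Drazin inverse inverts `φ` on the finite-dimensional summand. -/
theorem IsGDrazin.apply_apply (hφ : IsAST φ W U m) {g : Module.End k V}
    (hg : IsGDrazin φ m g) : ∀ w ∈ W, g (φ w) = w := by
  intro w hw
  obtain ⟨P, hPmem, -, -, hPpow⟩ := hφ.exists_projection
  obtain ⟨v, hv, hvw⟩ := hφ.exists_pow_eq m w hw
  have hcomm : g (φ w) = (φ ^ m) (g (φ v)) := by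
    have h₁ : φ w = (φ ^ m) (φ v) := by
      rw [← hvw, ← Module.End.mul_apply, ← Module.End.mul_apply, ← pow_succ, ← pow_succ']
    rw [h₁]
    exact LinearMap.congr_fun hg.2 (φ v)
  have hmem : g (φ w) ∈ W := by
    rw [hcomm, ← hPpow]
    exact hφ.pow_mem m _ (hPmem _)
  exact hφ.2.2.2.2.1.injOn hmem hw (LinearMap.congr_fun hg.1 w)

theorem GD1Le.eq_on_and_minusLe (hφ : IsAST φ W U m) (h : GD1Le φ m ψ) :
    (∀ w ∈ W, φ w = ψ w) ∧ MinusLe φ ψ := by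
  obtain ⟨τ, ⟨-, g, h, hg, -, hτφ, -⟩, hφτ, hτψ⟩ := h
  have hone : φ * τ * φ = φ := by rw [mul_assoc, hτφ, ← mul_assoc, hg.1]
  refine ⟨fun w hw => ?_, τ, hone, hτψ, hφτ⟩
  have hw' : τ (φ w) = w :=
    (LinearMap.congr_fun hτφ w).trans (hg.apply_apply hφ w hw)
  have := LinearMap.congr_fun hφτ (φ w)
  simpa [hw'] using this

theorem MinusLe.gd1Le (hφ : IsAST φ W U m) (hW : ∀ w ∈ W, φ w = ψ w)
    (h : MinusLe φ ψ) : GD1Le φ m ψ := by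
  obtain ⟨h, hone, hψ, hψ'⟩ := h
  obtain ⟨P, hPmem, hPW, hPφ, hPpow⟩ := hφ.exists_projection
  have hbij := hφ.2.2.2.2.1
  have hφhφ : ∀ x, φ (h (φ x)) = φ x := LinearMap.congr_fun hone
  have hhψ : ∀ x, h (ψ x) = h (φ x) := fun x => (LinearMap.congr_fun hψ x).symm
  have hψh : ∀ x, ψ (h x) = φ (h x) := fun x => (LinearMap.congr_fun hψ' x).symm
  have hPP : ∀ x, P (P x) = P x := fun x => hPW _ (hPmem x)
  have hψP : ∀ x, ψ (P x) = φ (P x) := fun x => (hW _ (hPmem x)).symm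
  -- `E` is the projection along `ker φ` whose range lies in `ker (ψ - φ)`, commuting with `P`.
  let E : Module.End k V := P + (1 - P) * (h * φ) * (1 - P)
  have hE : ∀ x, E x = P x + (h (φ (x - P x)) - P (h (φ (x - P x)))) := fun x => rfl
  have hφE : ∀ x, φ (E x) = φ x := by
    intro x
    rw [hE, map_add, map_sub, ← hPφ (h _), hφhφ, hPφ, map_sub φ, map_sub P, hPP]
    simp
  have hψE : ∀ x, ψ (E x) = φ (E x) := by
    intro x
    simp only [hE, map_add, map_sub, hψP, hψh]
  have hEW : ∀ w ∈ W, E w = w := by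
    intro w hw
    simp [hE, hPW w hw]
  have hEP : ∀ x, P (E x) = P x := by
    intro x
    simp [hE, hPP]
  have hker : ∀ x, φ x = 0 → E x = 0 := by
    intro x hx
    have hPx : P x = 0 := by
      refine hbij.injOn (hPmem x) W.zero_mem ?_
      rw [← hPφ, hx, map_zero, map_zero]
    simp [hE, hPx, hx]
  have hEhφ : ∀ x, E (h (φ x)) = E x := fun x => by
    rw [← sub_eq_zero, ← map_sub]
    exact hker _ (by rw [map_sub, hφhφ, sub_self])
  have hEE : ∀ x, E (E x) = E x := fun x => by
    rw [← sub_eq_zero, ← map_sub]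
    exact hker _ (by rw [map_sub, hφE, sub_self])
  let τ : Module.End k V := E * (h * φ * h)
  have hτ : ∀ x, τ x = E (h (φ (h x))) := fun x => rfl
  have hτφ : ∀ x, τ (φ x) = E x := fun x => by rw [hτ, hφhφ, hEhφ]
  have hφτ : ∀ x, φ (τ x) = φ (h x) := fun x => by rw [hτ, hφE, hφhφ]
  let g : Module.End k V := P * τ * P + (1 - P) * τ * (1 - P)
  have hg : ∀ x, g x = P (τ (P x)) + (τ (x - P x) - P (τ (x - P x))) := fun x => rfl
  have hgφ : ∀ x, g (φ x) = E x := by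
    intro x
    rw [hg, hPφ, ← map_sub, hτφ, hτφ, hEW _ (hPmem x), map_sub E, hEW _ (hPmem x), map_sub P, hEP]
    simp [hPP]
  refine ⟨τ, ⟨?_, g, h, ⟨?_, ?_⟩, hone, ?_, ?_⟩, ?_, ?_⟩ <;> ext x <;>
    simp only [Module.End.mul_apply]
  · rw [hτφ, hτ, hEE]
  · rw [hgφ, hφE]
  · obtain ⟨w, hw, hwx⟩ := hbij.surjOn (hPmem x)
    have hmem : (φ ^ m) w ∈ W := hφ.pow_mem m w hw
    have hpow : (φ ^ m) x = φ ((φ ^ m) w) := by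
      rw [← hPpow, ← hwx, ← Module.End.mul_apply, ← Module.End.mul_apply, ← pow_succ, ← pow_succ']
    rw [hpow, hgφ, hEW _ hmem, hg, ← hwx, hτφ, hEW w hw, hPW w hw, map_add, map_sub, hPpow,
      sub_self, add_zero]
  · rw [hτφ, hgφ]
  · rw [hφτ]
  · rw [hτ, hψE]
  · rw [hτ, hτ, hhψ]

end

theorem stmt13 {k V : Type*} [Field k] [AddCommGroup V] [Module k V]
    (φ ψ : Module.End k V) (Wφ Uφ : Submodule k V) (m : ℕ)
    (hASTφ : IsAST φ Wφ Uφ m) (hψ : IsFinitePotent ψ) :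
    GD1Le φ m ψ ↔ (∀ w ∈ Wφ, φ w = ψ w) ∧ MinusLe φ ψ :=
  ⟨GD1Le.eq_on_and_minusLe hASTφ, fun h => h.2.gd1Le hASTφ h.1⟩
end

section
/- The relation ≤^{GD1} is a partial order on the set of finite potent endomorphisms of V: for all finite potent φ, ψ, γ ∈ End(V), (i) φ ≤^{GD1} φ; (ii) if φ ≤^{GD1} ψ and ψ ≤^{GD1} φ then φ = ψ; (iii) if φ ≤^{GD1} ψ and ψ ≤^{GD1} γ then φ ≤^{GD1} γ. -/
/-- `d` is a Drazin inverse of `a`, with exponent `m`. -/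
structure IsDrazinInv {R : Type*} [Monoid R] (a : R) (m : ℕ) (d : R) : Prop where
  commute : Commute a d
  mul_mul_self : d * a * d = d
  pow_succ_mul : a ^ (m + 1) * d = a ^ m

namespace IsDrazinInv

section Monoid

variable {R : Type*} [Monoid R] {a d : R} {m : ℕ}

/-- An element that is strongly `π`-regular on both sides has a Drazin inverse. -/
theorem exists_of_pow_eq {x y : R} (hx : a ^ (m + 1) * x = a ^ m)
    (hy : y * a ^ (m + 1) = a ^ m) : ∃ d, IsDrazinInv a m d := by
  have hX : ∀ j, a ^ (m + j) * x ^ j = a ^ m := by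
    intro j
    induction j with
    | zero => simp
    | succ j ih =>
      rw [show m + (j + 1) = j + (m + 1) by omega, pow_add, pow_succ' x, mul_assoc,
        ← mul_assoc _ x, hx, ← mul_assoc, ← pow_add, add_comm j m, ih]
  have hY : ∀ j, y ^ j * a ^ (m + j) = a ^ m := by
    intro j
    induction j with
    | zero => simp
    | succ j ih =>
      rw [show m + (j + 1) = (m + 1) + j by omega, pow_succ y j, pow_add, mul_assoc,
        ← mul_assoc y, hy, ← pow_add, ih]
  have hXY : ∀ j, y ^ j * a ^ m = a ^ m * x ^ j := by
    intro j
    calc y ^ j * a ^ m = y ^ j * (a ^ (m + j) * x ^ j) := by rw [hX]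
      _ = a ^ m * x ^ j := by rw [← mul_assoc, hY]
  have had : a * (a ^ m * x ^ (m + 1)) = a ^ m * x ^ m := by
    rw [← mul_assoc, ← pow_succ', pow_succ' x, ← mul_assoc, hx]
  have hda : a ^ m * x ^ (m + 1) * a = a ^ m * x ^ m := by
    rw [← hXY, mul_assoc, ← pow_succ, pow_succ y, mul_assoc, hy, hXY]
  refine ⟨a ^ m * x ^ (m + 1), ?_, ?_, ?_⟩
  · exact had.trans hda.symm
  · rw [hda, ← hXY m, mul_assoc, ← mul_assoc (a ^ m), ← pow_add, ← mul_assoc, hY]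
  · rw [← mul_assoc, ← pow_add, add_comm (m + 1) m, hX]

theorem mul_pow_succ (h : IsDrazinInv a m d) : d * a ^ (m + 1) = a ^ m := by
  rw [← (h.commute.pow_left _).eq, h.pow_succ_mul]

theorem pow_mul_mul (h : IsDrazinInv a m d) : a ^ m * (a * d) = a ^ m := by
  rw [← mul_assoc, ← pow_succ, h.pow_succ_mul]

theorem mul_mul_pow (h : IsDrazinInv a m d) : a * d * a ^ m = a ^ m := by
  rw [h.commute.eq, mul_assoc, ← pow_succ', h.mul_pow_succ]

theorem pow_eq_pow_add_mul (h : IsDrazinInv a m d) (j : ℕ) :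
    a ^ m = a ^ j * (a ^ m * d ^ j) := by
  induction j with
  | zero => simp
  | succ j ih =>
    calc a ^ m = a ^ j * (a ^ m * d ^ j) := ih
      _ = a ^ j * (a ^ (m + 1) * d * d ^ j) := by rw [h.pow_succ_mul]
      _ = a ^ (j + 1) * (a ^ m * d ^ (j + 1)) := by
        rw [pow_succ' a m, pow_succ a j, pow_succ' d j]
        simp only [mul_assoc]

/-- A Drazin inverse is a right multiple of `a ^ m`. -/
theorem eq_pow_mul (h : IsDrazinInv a m d) : d = a ^ m * d ^ (m + 1) := by
  have key : ∀ j, d = a ^ j * d ^ (j + 1) := by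
    intro j
    induction j with
    | zero => simp
    | succ j ih =>
      have h2 : a * d ^ 2 = d := by
        rw [sq, ← mul_assoc, h.commute.eq, h.mul_mul_self]
      calc d = a ^ j * d ^ (j + 1) := ih
        _ = a ^ j * (a * d ^ 2 * d ^ j) := by rw [h2, pow_succ' d j]
        _ = a ^ (j + 1) * d ^ (j + 1 + 1) := by
          rw [pow_succ a j, show j + 1 + 1 = 2 + j by omega, pow_add d]
          simp only [mul_assoc]
  exact key m

end Monoid

section Ring

variable {R : Type*} [Ring R] {a d : R} {m : ℕ}

theorem add_compress_mul_pow (h : IsDrazinInv a m d) (x : R) :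
    (d + (1 - a * d) * x * (1 - a * d)) * a ^ m
      = a ^ m * (d + (1 - a * d) * x * (1 - a * d)) := by
  have h1 : (1 - a * d) * a ^ m = 0 := by rw [sub_mul, one_mul, h.mul_mul_pow, sub_self]
  have h2 : a ^ m * (1 - a * d) = 0 := by rw [mul_sub, mul_one, h.pow_mul_mul, sub_self]
  rw [add_mul, mul_add, mul_assoc _ _ (a ^ m), h1, mul_zero, mul_assoc (1 - a * d) x,
    ← mul_assoc (a ^ m), h2, zero_mul, (h.commute.pow_left m).eq]

theorem commute_compl (h : IsDrazinInv a m d) : Commute a (1 - a * d) :=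
  (Commute.one_right a).sub_right ((Commute.refl a).mul_right h.commute)

theorem mul_add_compress_mul (h : IsDrazinInv a m d) {x : R} (hx : a * x * a = a) :
    a * (d + (1 - a * d) * x * (1 - a * d)) * a = a := by
  have hP : d * (a * d) = d := by rw [← mul_assoc, h.mul_mul_self]
  have hc := h.commute_compl.eq
  calc a * (d + (1 - a * d) * x * (1 - a * d)) * a
      = a * d * a + a * (1 - a * d) * x * ((1 - a * d) * a) := by noncomm_ring
    _ = a * d * a + (1 - a * d) * (a * x * a) * (1 - a * d) := by
        rw [← hc]; nth_rewrite 1 [hc]; simp only [mul_assoc]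
    _ = a * d * a + a * (1 - a * d) * (1 - a * d) := by rw [hx, hc]
    _ = a * (d * a) + a * (1 - a * d - a * d + a * (d * (a * d))) := by noncomm_ring
    _ = a := by rw [hP, ← h.commute.eq]; noncomm_ring

theorem add_compress_mul (h : IsDrazinInv a m d) {x : R} (hx : a * x * a = a)
    (hpow : x * a ^ (m + 1) = a ^ m) :
    (d + (1 - a * d) * x * (1 - a * d)) * a = x * a := by
  have hxd : x * a * d = d := by
    conv_lhs => rw [h.eq_pow_mul]
    rw [mul_assoc, ← mul_assoc a, ← pow_succ', ← mul_assoc, hpow, ← h.eq_pow_mul]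
  have hdx : a * d * x * a = a * d := by
    rw [h.commute.eq, mul_assoc, mul_assoc, ← mul_assoc a, hx]
  have hc := h.commute_compl.eq
  calc (d + (1 - a * d) * x * (1 - a * d)) * a
      = d * a + (1 - a * d) * x * ((1 - a * d) * a) := by noncomm_ring
    _ = d * a + (1 - a * d) * x * (a * (1 - a * d)) := by rw [hc]
    _ = d * a + (x * a - a * d * x * a) * (1 - a * d) := by noncomm_ring
    _ = d * a + (x * a - x * a * d * a) + (a * d * (a * d) - a * d) := by
        rw [hdx, mul_assoc (x * a) d a, ← h.commute.eq]; noncomm_ring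
    _ = x * a := by
        rw [hxd, ← mul_assoc (a * d), mul_assoc a d a, mul_assoc, h.mul_mul_self]; noncomm_ring

end Ring

end IsDrazinInv

section

variable {k V : Type*} [Field k] [AddCommGroup V] [Module k V]

theorem exists_isOneInv (f : Module.End k V) : ∃ h, IsOneInv f h := by
  obtain ⟨s, hs⟩ := f.rangeRestrict.exists_rightInverse_of_surjective f.range_rangeRestrict
  obtain ⟨t, ht⟩ := LinearMap.exists_extend s
  refine ⟨t, LinearMap.ext fun v => ?_⟩
  have h1 : t (f v) = s (f.rangeRestrict v) := LinearMap.congr_fun ht (f.rangeRestrict v)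
  have h2 := congrArg Subtype.val (LinearMap.congr_fun hs (f.rangeRestrict v))
  simpa [h1] using h2

namespace IsFinitePotent

variable {φ : Module.End k V}

theorem exists_ker_pow_eq (hφ : IsFinitePotent φ) :
    ∃ m, LinearMap.ker (φ ^ m) = LinearMap.ker (φ ^ (m + 1)) := by
  obtain ⟨n, hn⟩ := hφ
  have hmaps : ∀ v ∈ LinearMap.range (φ ^ n), φ v ∈ LinearMap.range (φ ^ n) := by
    rintro _ ⟨w, rfl⟩
    exact ⟨φ w, by rw [← Module.End.mul_apply, ← Module.End.mul_apply, ← pow_succ, pow_succ']⟩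
  obtain ⟨j, -, hj⟩ := Module.End.exists_ker_pow_eq_ker_pow_succ (φ.restrict hmaps)
  have key : ∀ i v, v ∈ LinearMap.ker (φ ^ (i + n)) ↔
      (⟨(φ ^ n) v, v, rfl⟩ : LinearMap.range (φ ^ n)) ∈
        LinearMap.ker ((φ.restrict hmaps) ^ i) := by
    intro i v
    rw [LinearMap.mem_ker, LinearMap.mem_ker, Module.End.pow_restrict i, ← Subtype.coe_inj]
    simp [pow_add]
  refine ⟨j + n, Submodule.ext fun v => ?_⟩
  rw [add_right_comm, key, key, hj]

theorem ker_pow_endIndex (hφ : IsFinitePotent φ) :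
    LinearMap.ker (φ ^ endIndex φ) = LinearMap.ker (φ ^ (endIndex φ + 1)) :=
  Nat.sInf_mem hφ.exists_ker_pow_eq

theorem finiteDimensional_range_pow_endIndex (hφ : IsFinitePotent φ) :
    FiniteDimensional k (LinearMap.range (φ ^ endIndex φ)) := by
  have hker := Module.End.ker_pow_constant hφ.ker_pow_endIndex
  obtain ⟨n, hn⟩ := hφ
  have hfin : FiniteDimensional k (LinearMap.range (φ ^ (endIndex φ + n))) := by
    have hle : LinearMap.range (φ ^ (endIndex φ + n)) ≤ LinearMap.range (φ ^ n) := by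
      rw [add_comm, pow_add]
      exact LinearMap.range_comp_le_range _ _
    exact Submodule.finiteDimensional_of_le hle
  exact Module.Finite.equiv
    ((φ ^ (endIndex φ + n)).quotKerEquivRange.symm ≪≫ₗ
      Submodule.quotEquivOfEq _ _ (hker n).symm ≪≫ₗ (φ ^ endIndex φ).quotKerEquivRange)

theorem range_pow_endIndex (hφ : IsFinitePotent φ) :
    LinearMap.range (φ ^ (endIndex φ + 1)) = LinearMap.range (φ ^ endIndex φ) := by
  have := hφ.finiteDimensional_range_pow_endIndex
  refine Submodule.eq_of_le_of_finrank_eq ?_ ?_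
  · rw [pow_succ]
    exact LinearMap.range_comp_le_range _ _
  · exact LinearEquiv.finrank_eq
      ((φ ^ (endIndex φ + 1)).quotKerEquivRange.symm ≪≫ₗ
        Submodule.quotEquivOfEq _ _ hφ.ker_pow_endIndex.symm ≪≫ₗ
          (φ ^ endIndex φ).quotKerEquivRange)

theorem exists_isDrazinInv (hφ : IsFinitePotent φ) :
    ∃ d, IsDrazinInv φ (endIndex φ) d := by
  obtain ⟨h, hh⟩ := exists_isOneInv (φ ^ (endIndex φ + 1))
  have hh' : ∀ v, (φ ^ (endIndex φ + 1)) (h ((φ ^ (endIndex φ + 1)) v))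
      = (φ ^ (endIndex φ + 1)) v := LinearMap.congr_fun hh
  refine IsDrazinInv.exists_of_pow_eq (x := h * φ ^ endIndex φ) (y := φ ^ endIndex φ * h) ?_ ?_
  · refine LinearMap.ext fun v => ?_
    obtain ⟨w, hw⟩ := hφ.range_pow_endIndex.ge (LinearMap.mem_range_self (φ ^ endIndex φ) v)
    simp only [Module.End.mul_apply, ← hw, hh']
  · refine LinearMap.ext fun v => ?_
    have hmem : h ((φ ^ (endIndex φ + 1)) v) - v ∈ LinearMap.ker (φ ^ endIndex φ) := by
      rw [hφ.ker_pow_endIndex, LinearMap.mem_ker, map_sub, hh', sub_self]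
    rw [LinearMap.mem_ker, map_sub, sub_eq_zero] at hmem
    simpa only [Module.End.mul_apply] using hmem

end IsFinitePotent

variable {φ ψ γ τ σ d : Module.End k V} {m n : ℕ}

theorem IsGD1.isOneInv (h : IsGD1 φ m τ) : IsOneInv φ τ := by
  obtain ⟨-, g, -, hg, -, hτg, -⟩ := h
  rw [IsOneInv, mul_assoc, hτg, ← mul_assoc, hg.1]

theorem IsGD1.mul_pow_succ (h : IsGD1 φ m τ) (hd : IsDrazinInv φ m d) :
    τ * φ ^ (m + 1) = φ ^ m := by
  obtain ⟨-, g, -, hg, -, hτg, -⟩ := h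
  calc τ * φ ^ (m + 1) = g * φ ^ m * φ := by
        rw [pow_succ', ← mul_assoc, hτg, mul_assoc, mul_assoc, ← pow_succ', pow_succ]
    _ = d * φ ^ (m + 1) * g * φ := by rw [hg.2, hd.mul_pow_succ]
    _ = d * (φ ^ m * (φ * g * φ)) := by rw [pow_succ]; simp only [mul_assoc]
    _ = φ ^ m := by rw [hg.1, ← pow_succ, hd.mul_pow_succ]

/-- GD1 inverses are the reflexive inverses `τ` with `τ * φ ^ (m + 1) = φ ^ m`. -/
theorem isGD1_of_mul_pow_succ (hd : IsDrazinInv φ m d) (h₁ : IsOneInv φ τ)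
    (h₂ : τ * φ * τ = τ) (hpow : τ * φ ^ (m + 1) = φ ^ m) : IsGD1 φ m τ :=
  ⟨h₂, _, τ, ⟨hd.mul_add_compress_mul h₁, hd.add_compress_mul_pow τ⟩, h₁,
    (hd.add_compress_mul h₁ hpow).symm, rfl⟩

theorem exists_isGD1 (hd : IsDrazinInv φ m d) : ∃ τ, IsGD1 φ m τ := by
  obtain ⟨h, hh⟩ := exists_isOneInv φ
  have hg := hd.mul_add_compress_mul hh
  have hc := hd.add_compress_mul_pow h
  generalize d + (1 - φ * d) * h * (1 - φ * d) = g at hg hc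
  refine ⟨g * φ * g, ?_, g, g, ⟨hg, hc⟩, hg, ?_, ?_⟩
  · have hg' : ∀ x, φ * (g * (φ * x)) = φ * x := fun x => by
      rw [← mul_assoc, ← mul_assoc, hg]
    simp only [mul_assoc, hg']
  · rw [mul_assoc, mul_assoc, ← mul_assoc φ, hg]
  · rw [← mul_assoc, ← mul_assoc, hg]

theorem GD1Le.refl (hd : IsDrazinInv φ m d) : GD1Le φ m φ :=
  (exists_isGD1 hd).imp fun _ hτ => ⟨hτ, rfl, rfl⟩

theorem GD1Le.antisymm (h : GD1Le φ m ψ) (h' : GD1Le ψ n φ) : φ = ψ := by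
  obtain ⟨τ, hτ, h₁, h₂⟩ := h
  obtain ⟨σ, hσ, h₃, h₄⟩ := h'
  have hψ : φ * (σ * ψ) = ψ := by rw [← mul_assoc, ← h₃, hσ.isOneInv]
  calc φ = φ * τ * φ := hτ.isOneInv.symm
    _ = φ * τ * ψ := by rw [mul_assoc, h₂, ← mul_assoc]
    _ = φ * τ * φ * (σ * ψ) := by rw [mul_assoc (φ * τ), hψ]
    _ = ψ := by rw [hτ.isOneInv, hψ]

theorem GD1Le.trans {e : Module.End k V} (hd : IsDrazinInv φ m d) (he : IsDrazinInv ψ n e)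
    (h : GD1Le φ m ψ) (h' : GD1Le ψ n γ) : GD1Le φ m γ := by
  obtain ⟨τ, hτ, h₁, h₂⟩ := h
  obtain ⟨σ, hσ, h₃, h₄⟩ := h'
  have hφ : φ * τ * φ = φ := hτ.isOneInv
  have hψ : ψ * σ * ψ = ψ := hσ.isOneInv
  have hl : φ = ψ * (τ * φ) := by rw [← mul_assoc, ← h₁, hφ]
  have hr : φ = φ * τ * ψ := by rw [mul_assoc, ← h₂, ← mul_assoc, hφ]
  have hψσ : ψ * σ * φ = φ := by
    conv_lhs => rw [hl]
    rw [← mul_assoc, hψ, ← hl]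
  have hσψ : φ * σ * ψ = φ := by
    conv_lhs => rw [hr]
    rw [mul_assoc, mul_assoc, ← mul_assoc ψ, hψ, ← hr]
  have hφσ : φ * σ * φ = φ := by
    calc φ * σ * φ = φ * σ * (ψ * (τ * φ)) := by rw [← hl]
      _ = φ := by rw [← mul_assoc, hσψ, ← mul_assoc, hφ]
  have hpow : ∀ j, φ ^ (m + j) = ψ ^ j * φ ^ m := by
    intro j
    induction j with
    | zero => simp
    | succ j ih =>
      have hstep : ψ * φ ^ m = φ ^ (m + 1) := by
        rw [← hτ.mul_pow_succ hd, pow_succ', ← mul_assoc τ, ← mul_assoc ψ, ← hl]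
      rw [pow_succ ψ, mul_assoc, hstep, pow_succ, ← mul_assoc, ← ih, ← pow_succ, add_assoc]
  have hσpow : σ * φ ^ (m + 1) = φ ^ m := by
    have hm : φ ^ m = ψ ^ n * (φ ^ m * d ^ n) := by
      rw [← mul_assoc, ← hpow, add_comm, pow_add, mul_assoc]
      exact hd.pow_eq_pow_add_mul n
    calc σ * φ ^ (m + 1) = σ * (ψ * φ ^ m) := by rw [hpow 1, pow_one]
      _ = σ * ψ ^ (n + 1) * (φ ^ m * d ^ n) := by
        conv_lhs => rw [hm]
        rw [pow_succ']; simp only [mul_assoc]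
      _ = φ ^ m := by rw [hσ.mul_pow_succ he, ← hm]
  have hρ : σ * φ * σ * φ = σ * φ := by rw [mul_assoc, mul_assoc, ← mul_assoc φ, hφσ]
  have hρ' : φ * (σ * φ * σ) = φ * σ := by rw [← mul_assoc, ← mul_assoc, hφσ]
  refine ⟨σ * φ * σ, isGD1_of_mul_pow_succ hd ?_ ?_ ?_, ?_, ?_⟩
  · rw [IsOneInv, hρ', hφσ]
  · rw [hρ, mul_assoc, hρ', ← mul_assoc]
  · rw [pow_succ', ← mul_assoc, hρ, mul_assoc, ← pow_succ', hσpow]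
  · have : γ * σ * φ = φ := by rw [← h₃, hψσ]
    rw [hρ', ← mul_assoc, ← mul_assoc, this]
  · rw [hρ, mul_assoc, ← h₄, mul_assoc, ← mul_assoc φ, hσψ]

end

theorem stmt14 {k V : Type*} [Field k] [AddCommGroup V] [Module k V] :
    (∀ φ : Module.End k V, IsFinitePotent φ → GD1Le φ (endIndex φ) φ) ∧
    (∀ φ ψ : Module.End k V, IsFinitePotent φ → IsFinitePotent ψ →
      GD1Le φ (endIndex φ) ψ → GD1Le ψ (endIndex ψ) φ → φ = ψ) ∧
    (∀ φ ψ γ : Module.End k V, IsFinitePotent φ → IsFinitePotent ψ →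
      IsFinitePotent γ → GD1Le φ (endIndex φ) ψ → GD1Le ψ (endIndex ψ) γ →
      GD1Le φ (endIndex φ) γ) := by
  refine ⟨fun φ hφ => ?_, fun φ ψ _ _ h h' => h.antisymm h', fun φ ψ γ hφ hψ _ h h' => ?_⟩
  · obtain ⟨d, hd⟩ := hφ.exists_isDrazinInv
    exact GD1Le.refl hd
  · obtain ⟨d, hd⟩ := hφ.exists_isDrazinInv
    obtain ⟨e, he⟩ := hψ.exists_isDrazinInv
    exact h.trans hd he h'
end

section
/- Let φ ∈ End(V) admit an AST decomposition with subspaces W, U and index m, and let ψ ∈ End(V) be arbitrary. Then φ^{m+1} = φ^m∘ψ if and only if range(ψ − φ) ⊆ U. Consequently, under either equivalent condition, ψ = φ + θ for some θ ∈ End(V) with range(θ) ⊆ U. -/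
/-- In an AST decomposition of index `m`, the nilpotent part is the kernel of `φ ^ m`. -/
theorem IsAST.ker_pow_eq {k V : Type*} [Field k] [AddCommGroup V] [Module k V]
    {φ : Module.End k V} {W U : Submodule k V} {m : ℕ} (h : IsAST φ W U m) :
    LinearMap.ker (φ ^ m) = U := by
  obtain ⟨hc, -, -, -, hbij, hm, -⟩ := h
  refine le_antisymm (fun x hx => ?_) (fun u hu => hm u hu)
  obtain ⟨w, hw, u, hu, rfl⟩ := Submodule.mem_sup.1 (hc.sup_eq_top ▸ Submodule.mem_top (x := x))
  have hx' : (φ ^ m) w = 0 := by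
    simpa [hm u hu] using hx
  have hinj : Set.InjOn (⇑(φ ^ m)) (W : Set V) := by
    rw [Module.End.coe_pow]
    exact hbij.injOn.iterate hbij.mapsTo m
  have hw0 : w = 0 := hinj hw W.zero_mem (by rw [hx', map_zero])
  simpa [hw0] using hu

theorem stmt15 {k V : Type*} [Field k] [AddCommGroup V] [Module k V]
    (φ : Module.End k V) (W U : Submodule k V) (m : ℕ)
    (hAST : IsAST φ W U m) (ψ : Module.End k V) :
    (φ ^ (m + 1) = φ ^ m * ψ ↔ LinearMap.range (ψ - φ) ≤ U) ∧
    (φ ^ (m + 1) = φ ^ m * ψ →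
      ∃ θ : Module.End k V, ψ = φ + θ ∧ LinearMap.range θ ≤ U) := by
  have key : φ ^ (m + 1) = φ ^ m * ψ ↔ LinearMap.range (ψ - φ) ≤ U := by
    rw [← hAST.ker_pow_eq, LinearMap.range_le_ker_iff, ← Module.End.mul_eq_comp, mul_sub,
      sub_eq_zero, pow_succ, eq_comm]
  exact ⟨key, fun h => ⟨ψ - φ, (add_sub_cancel φ ψ).symm, key.1 h⟩⟩
end

section
/- Let φ, ψ ∈ End(V) be finite potent endomorphisms. Then: (I) there exists τ ∈ End(V) which is simultaneously a G-Drazin inverse and a {1,2}-inverse of φ and satisfies φ∘τ = ψ∘τ and τ∘φ = τ∘ψ, if and only if φ ≤^{GD} ψ (G-Drazin order); and (II) there exists a {1,2}-inverse τ of φ satisfying φ∘τ = ψ∘τ and τ∘φ = τ∘ψ, if and only if φ ≤^- ψ (minus order). -/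
section InnerInverse

variable {M : Type*} [Monoid M] {a b g : M}

theorem mul_mul_mul_self_of_inner_inverse (h : a * g * a = a) :
    a * (g * a * g) * a = a := by
  simp only [← mul_assoc, h]

theorem mul_mul_mul_outer_of_inner_inverse (h : a * g * a = a) :
    (g * a * g) * a * (g * a * g) = g * a * g := by
  simp only [mul_assoc] at h ⊢
  rw [← mul_assoc a g (a * g), ← mul_assoc (a * g) a g, mul_assoc a g a, h,
    ← mul_assoc a g (a * g), ← mul_assoc (a * g) a g, mul_assoc a g a, h]

theorem mul_mul_mul_comm_pow {m : ℕ} (h : g * a ^ m = a ^ m * g) :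
    g * a * g * a ^ m = a ^ m * (g * a * g) := by
  have hg : Commute g (a ^ m) := h
  have ha : Commute a (a ^ m) := Commute.self_pow a m
  exact ((hg.mul_left ha).mul_left hg).eq

theorem mul_left_eq_of_reflexive (h : a * g = b * g) :
    a * (g * a * g) = b * (g * a * g) := by
  simp only [← mul_assoc, h]

theorem mul_right_eq_of_reflexive (h : g * a = g * b) :
    g * a * g * a = g * a * g * b := by
  rw [mul_assoc, h, ← mul_assoc]

end InnerInverse

theorem stmt19 {k V : Type*} [Field k] [AddCommGroup V] [Module k V]
    (φ ψ : Module.End k V) (hφ : IsFinitePotent φ) (hψ : IsFinitePotent ψ) :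
    ((∃ τ : Module.End k V, IsGDrazin φ (endIndex φ) τ ∧
        (φ * τ * φ = φ ∧ τ * φ * τ = τ) ∧ φ * τ = ψ * τ ∧ τ * φ = τ * ψ) ↔
      ∃ g : Module.End k V, IsGDrazin φ (endIndex φ) g ∧
        φ * g = ψ * g ∧ g * φ = g * ψ) ∧
    ((∃ τ : Module.End k V, (φ * τ * φ = φ ∧ τ * φ * τ = τ) ∧
        φ * τ = ψ * τ ∧ τ * φ = τ * ψ) ↔ MinusLe φ ψ) := by
  refine ⟨⟨?_, ?_⟩, ⟨?_, ?_⟩⟩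
  · rintro ⟨τ, hτ, -, hl, hr⟩
    exact ⟨τ, hτ, hl, hr⟩
  · rintro ⟨g, ⟨hg, hc⟩, hl, hr⟩
    exact ⟨g * φ * g, ⟨mul_mul_mul_self_of_inner_inverse hg, mul_mul_mul_comm_pow hc⟩,
      ⟨mul_mul_mul_self_of_inner_inverse hg, mul_mul_mul_outer_of_inner_inverse hg⟩,
      mul_left_eq_of_reflexive hl, mul_right_eq_of_reflexive hr⟩
  · rintro ⟨τ, ⟨hτ, -⟩, hl, hr⟩
    exact ⟨τ, hτ, hr, hl⟩
  · rintro ⟨g, hg, hr, hl⟩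
    exact ⟨g * φ * g,
      ⟨mul_mul_mul_self_of_inner_inverse hg, mul_mul_mul_outer_of_inner_inverse hg⟩,
      mul_left_eq_of_reflexive hl, mul_right_eq_of_reflexive hr⟩
end
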